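/- For every algebraic complex number α with log(α) ≠ 0, the number log(α) is transcendental. -/

import Mathlib

open Polynomial Filter Topology
open scoped Nat

/-- Finitely many nonzero algebraic numbers are common roots of an integer polynomial that does not
vanish at `0`. -/
theorem exists_int_polynomial_eval_zero_ne_zero {K : Type*} [Field K] [CharZero K]
    [Algebra.IsAlgebraic ℚ K] (s : Finset K) (hs : 0 ∉ s) :
    ∃ T : ℤ[X], T.eval 0 ≠ 0 ∧ ∀ γ ∈ s, aeval γ T = 0 := by
  classical
  induction s using Finset.induction_on with
  | empty => exact ⟨1, by simp, by simp⟩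
  | insert a s ha ih =>
    obtain ⟨T, hT0, hT⟩ := ih fun h ↦ hs (Finset.mem_insert_of_mem h)
    have ha0 : a ≠ 0 := fun h ↦ hs (h ▸ Finset.mem_insert_self _ _)
    have halg : IsAlgebraic ℤ a :=
      (IsFractionRing.isAlgebraic_iff ℤ ℚ K).2 (Algebra.IsAlgebraic.isAlgebraic a)
    obtain ⟨q, hq0, hq⟩ := halg.exists_nonzero_coeff_and_aeval_eq_zero
      (mem_nonZeroDivisors_of_ne_zero ha0)
    refine ⟨q * T, by simpa [← coeff_zero_eq_eval_zero, mul_coeff_zero] using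
      ⟨hq0, by simpa [coeff_zero_eq_eval_zero] using hT0⟩, fun γ hγ ↦ ?_⟩
    rcases Finset.mem_insert.1 hγ with rfl | hγ
    · simp [hq]
    · simp [hT γ hγ]

theorem isIntegral_pow_mul_aeval {R A : Type*} [CommRing R] [CommRing A] [Algebra R A] {a : R}
    {x : A} (hx : IsIntegral R (a • x)) (g : R[X]) {N : ℕ} (hg : g.natDegree ≤ N) :
    IsIntegral R (a ^ N • aeval x g) := by
  rw [aeval_eq_sum_range, Finset.smul_sum]
  refine IsIntegral.sum _ fun i hi ↦ ?_
  have hi' : i ≤ N := (Finset.mem_range_succ_iff.1 hi).trans hg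
  have : a ^ N • g.coeff i • x ^ i = (a ^ (N - i) * g.coeff i) • (a • x) ^ i := by
    rw [_root_.smul_pow, smul_smul, smul_smul, ← Nat.sub_add_cancel hi', pow_add]
    congr 1
    simp only [Nat.add_sub_cancel]
    ring
  rw [this]
  exact (hx.pow i).smul _

theorem exists_int_of_isIntegral_of_fixed {K : Type*} [Field K] [NumberField K] [IsGalois ℚ K]
    {x : K} (hx : IsIntegral ℤ x) (hfix : ∀ σ : Gal(K/ℚ), σ x = x) : ∃ m : ℤ, (m : K) = x := by
  obtain ⟨q, rfl⟩ := (IsGalois.mem_range_algebraMap_iff_fixed x).2 hfix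
  have hq : IsIntegral ℤ q :=
    (isIntegral_algebraMap_iff (algebraMap ℚ K).injective).1 hx
  obtain ⟨m, rfl⟩ := IsIntegrallyClosed.isIntegral_iff.1 hq
  exact ⟨m, by simp⟩

theorem eventually_mul_pow_div_factorial_pred_lt_one (C A : ℝ) :
    ∀ᶠ p : ℕ in atTop, C * (A ^ p / (p - 1)!) < 1 := by
  have h := (FloorSemiring.tendsto_pow_div_factorial_atTop A).const_mul (C * A)
  rw [mul_zero] at h
  have h' := h.comp (tendsto_sub_atTop_nat 1)
  filter_upwards [h'.eventually (gt_mem_nhds zero_lt_one), eventually_ge_atTop 1] with p hp hp1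
  obtain ⟨k, rfl⟩ := Nat.exists_eq_add_of_le' hp1
  simp only [Function.comp_apply, Nat.add_sub_cancel] at hp ⊢
  calc _ = C * A * (A ^ k / k !) := by ring
    _ < 1 := hp

theorem map_aeval_int {A B : Type*} [CommRing A] [CommRing B] (f : A →+* B) (x : A) (q : ℤ[X]) :
    f (aeval x q) = aeval (f x) q :=
  (aeval_algHom_apply f.toIntAlgHom x q).symm

/-- A Galois-invariant integer combination of exponentials of algebraic numbers in which `exp 0`
occurs does not vanish. -/
theorem sum_mul_exp_ne_zero_of_galois_invariant {K : Type*} [Field K] [NumberField K]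
    [IsGalois ℚ K] (ι : K →+* ℂ) (F : K →₀ ℤ) (hF : ∀ (σ : Gal(K/ℚ)) γ, F (σ γ) = F γ)
    (hF0 : F 0 ≠ 0) : ∑ γ ∈ F.support, F γ * Complex.exp (ι γ) ≠ 0 := by
  classical
  intro hsum
  set s := F.support.erase 0 with hs
  have hsplit : (F 0 : ℂ) + ∑ γ ∈ s, F γ * Complex.exp (ι γ) = 0 := by
    rw [← hsum, ← Finset.add_sum_erase _ _ (Finsupp.mem_support_iff.2 hF0), ← hs]
    simp
  obtain ⟨T, hT0, hT⟩ := exists_int_polynomial_eval_zero_ne_zero s (by simp [hs])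
  have hTne : T ≠ 0 := by rintro rfl; simp at hT0
  obtain ⟨c, hc⟩ := LindemannWeierstrass.exp_polynomial_approx T hT0
  set a := T.leadingCoeff with ha
  have ha0 : a ≠ 0 := leadingCoeff_ne_zero.2 hTne
  set C : ℝ := ∑ γ ∈ s, ‖(F γ : ℂ)‖
  obtain ⟨p₀, hp₀⟩ := eventually_atTop.1
    (eventually_mul_pow_div_factorial_pred_lt_one C (|(a : ℝ)| ^ T.natDegree * c))
  obtain ⟨p, hp_ge, hp⟩ := Nat.exists_infinite_primes
    (p₀ + (T.eval 0).natAbs + 1 + a.natAbs + (F 0).natAbs + 1)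
  obtain ⟨n, hpn, g, hg, happrox⟩ := hc p (by omega) hp
  set N := p * T.natDegree
  set S : K := ∑ γ ∈ s, F γ * aeval γ g with hS
  obtain ⟨m, hm⟩ : ∃ m : ℤ, (m : K) = a ^ N • S := by
    refine exists_int_of_isIntegral_of_fixed ?_ fun σ ↦ ?_
    · rw [hS, Finset.smul_sum]
      refine IsIntegral.sum _ fun γ hγ ↦ ?_
      rw [← zsmul_eq_mul, smul_comm]
      exact (isIntegral_pow_mul_aeval (isIntegral_leadingCoeff_smul T γ (hT γ hγ)) g
        (by omega)).smul _
    · rw [map_zsmul, hS, map_sum]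
      congr 1
      refine Finset.sum_equiv σ.toEquiv (fun γ ↦ ?_) fun γ _ ↦ ?_
      · simp [hs, hF]
      · have : σ (aeval γ g) = aeval (σ γ) g := map_aeval_int (σ : K →+* K) γ g
        simp [hF, this]
  have hmC : (m : ℂ) = (a : ℂ) ^ N * ∑ γ ∈ s, F γ * aeval (ι γ) g := by
    have := congrArg ι hm
    rw [map_intCast, zsmul_eq_mul, map_mul, hS, map_sum] at this
    rw [this]
    push_cast
    simp only [map_pow, map_intCast, map_mul, map_aeval_int]
  have hndvd : ¬ (p : ℤ) ∣ a ^ N * n * F 0 + p * m := by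
    have hprime := Nat.prime_iff_prime_int.1 hp
    have hlt : ∀ z : ℤ, z ≠ 0 → z.natAbs < p → ¬ (p : ℤ) ∣ z := fun z hz hzp h ↦
      hzp.not_ge (Nat.le_of_dvd (Int.natAbs_pos.2 hz) (Int.natCast_dvd.1 h))
    rw [dvd_add_left (dvd_mul_right _ _)]
    intro h
    rcases hprime.dvd_or_dvd h with h | h
    · rcases hprime.dvd_or_dvd h with h | h
      · exact hlt a ha0 (by omega) (hprime.dvd_of_dvd_pow h)
      · exact hpn h
    · exact hlt _ hF0 (by omega) h
  have hkey : ((a ^ N * n * F 0 + p * m : ℤ) : ℂ) =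
      -((a : ℂ) ^ N * ∑ γ ∈ s, F γ * (n • Complex.exp (ι γ) - p • aeval (ι γ) g)) := by
    have : ∑ γ ∈ s, (F γ : ℂ) * (n • Complex.exp (ι γ) - p • aeval (ι γ) g) =
        n * ∑ γ ∈ s, F γ * Complex.exp (ι γ) - p * ∑ γ ∈ s, F γ * aeval (ι γ) g := by
      rw [Finset.mul_sum, Finset.mul_sum, ← Finset.sum_sub_distrib]
      refine Finset.sum_congr rfl fun γ _ ↦ ?_
      simp only [zsmul_eq_mul, nsmul_eq_mul]
      ring
    rw [this, eq_neg_of_add_eq_zero_right hsplit]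
    push_cast
    rw [hmC]
    ring
  have hone : (1 : ℝ) ≤ ‖((a ^ N * n * F 0 + p * m : ℤ) : ℂ)‖ := by
    rw [Complex.norm_intCast]
    have hne : a ^ N * n * F 0 + p * m ≠ 0 := fun h ↦ hndvd (by rw [h]; exact dvd_zero _)
    exact_mod_cast Int.one_le_abs hne
  refine absurd (hp₀ p (by omega)) (not_lt.2 (hone.trans ?_))
  rw [hkey, norm_neg, norm_mul, norm_pow, Complex.norm_intCast]
  calc |(a : ℝ)| ^ N * ‖∑ γ ∈ s, (F γ : ℂ) * (n • Complex.exp (ι γ) - p • aeval (ι γ) g)‖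
      ≤ |(a : ℝ)| ^ N * ∑ γ ∈ s, ‖(F γ : ℂ)‖ * (c ^ p / (p - 1)!) := by
        gcongr
        refine norm_sum_le_of_le _ fun γ hγ ↦ ?_
        rw [norm_mul]
        gcongr
        exact happrox (mem_aroots.2 ⟨hTne, by rw [← map_aeval_int, hT γ hγ, map_zero]⟩)
    _ = C * ((|(a : ℝ)| ^ T.natDegree * c) ^ p / (p - 1)!) := by
        rw [← Finset.sum_mul, mul_pow, ← pow_mul, mul_comm T.natDegree p]
        ring

open AddMonoidAlgebra in
/-- From a nonzero element of `ℤ[K]`, one constructs a multiple of it that is Galois-invariant and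
has a nonzero coefficient at `0`. -/
theorem exists_galois_invariant_multiple {K : Type*} [Field K] [NumberField K]
    (f : AddMonoidAlgebra ℤ K) (hf : f ≠ 0) :
    ∃ F : AddMonoidAlgebra ℤ K, f ∣ F ∧ (∀ (σ : Gal(K/ℚ)) γ, F.coeff (σ γ) = F.coeff γ) ∧
      F.coeff 0 ≠ 0 := by
  classical
  let act (σ : Gal(K/ℚ)) : AddMonoidAlgebra ℤ K →+* AddMonoidAlgebra ℤ K :=
    mapDomainRingHom ℤ (σ : K →+ K)
  have act_coeff (σ : Gal(K/ℚ)) (x : AddMonoidAlgebra ℤ K) (γ : K) :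
      (act σ x).coeff (σ γ) = x.coeff γ :=
    Finsupp.mapDomain_apply σ.injective _ _
  have act_mul (σ τ : Gal(K/ℚ)) (x : AddMonoidAlgebra ℤ K) : act (σ * τ) x = act σ (act τ x) := by
    ext γ
    obtain ⟨γ, rfl⟩ := (σ * τ).surjective γ
    rw [act_coeff, AlgEquiv.mul_apply, act_coeff, act_coeff]
  have act_ne (σ : Gal(K/ℚ)) {x : AddMonoidAlgebra ℤ K} (hx : x ≠ 0) : act σ x ≠ 0 := by
    contrapose! hx
    ext γ
    rw [← act_coeff σ x, hx]
    rfl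
  have coeff_of_act {x : AddMonoidAlgebra ℤ K} (hx : ∀ σ, act σ x = x) (σ : Gal(K/ℚ)) (γ : K) :
      x.coeff (σ γ) = x.coeff γ := by
    conv_rhs => rw [← act_coeff σ x, hx]
  set P := ∏ σ : Gal(K/ℚ), act σ f with hP
  have hPinv (σ : Gal(K/ℚ)) : act σ P = P := by
    rw [hP, map_prod]
    exact Fintype.prod_equiv (Equiv.mulLeft σ) _ _ fun τ ↦ (act_mul σ τ f).symm
  have hP0 : P ≠ 0 := Finset.prod_ne_zero_iff.2 fun σ _ ↦ act_ne σ hf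
  obtain ⟨γ, hγ⟩ : ∃ γ, P.coeff γ ≠ 0 := by
    contrapose! hP0
    ext γ
    simp [hP0]
  set Q : AddMonoidAlgebra ℤ K := ∑ σ : Gal(K/ℚ), single (-(σ γ)) 1 with hQ
  have hQinv (σ : Gal(K/ℚ)) : act σ Q = Q := by
    rw [hQ, map_sum]
    refine Fintype.sum_equiv (Equiv.mulLeft σ) _ _ fun τ ↦ ?_
    simp [act]
  refine ⟨P * Q, Dvd.dvd.mul_right ?_ _,
    coeff_of_act fun σ ↦ by rw [map_mul, hPinv, hQinv], ?_⟩
  · have : act 1 f = f := by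
      ext γ
      exact act_coeff 1 f γ
    exact this ▸ Finset.dvd_prod_of_mem (fun σ ↦ act σ f) (Finset.mem_univ 1)
  · have : (P * Q).coeff 0 = Fintype.card Gal(K/ℚ) * P.coeff γ := by
      simp [hQ, Finset.mul_sum, coeff_of_act hPinv]
    rw [this]
    exact mul_ne_zero (by simp) hγ

open AddMonoidAlgebra in
/-- **Hermite–Lindemann theorem** for elements of a Galois number field. -/
theorem transcendental_exp_of_numberField {K : Type*} [Field K] [NumberField K] [IsGalois ℚ K]
    (ι : K →+* ℂ) {β : K} (hβ : β ≠ 0) : Transcendental ℤ (Complex.exp (ι β)) := by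
  classical
  rintro ⟨q, hq0, hq⟩
  let e : Multiplicative K →* ℂ :=
    { toFun γ := Complex.exp (ι γ.toAdd)
      map_one' := by simp
      map_mul' x y := by simp [Complex.exp_add] }
  let E : AddMonoidAlgebra ℤ K →ₐ[ℤ] ℂ := AddMonoidAlgebra.lift ℤ ℂ K e
  set f : AddMonoidAlgebra ℤ K := aeval (single β 1) q with hf
  have hEf : E f = 0 := by
    rw [hf, ← aeval_algHom_apply]
    simpa [E, e] using hq
  have hf0 : f ≠ 0 := by
    intro h
    have : f.coeff (q.natDegree • β) = q.leadingCoeff := by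
      rw [hf, aeval_eq_sum_range]
      simp [single_pow, Finsupp.single_apply, hβ]
    rw [h] at this
    exact hq0 (leadingCoeff_eq_zero.1 (by simpa using this.symm))
  obtain ⟨F, hfF, hF, hF0⟩ := exists_galois_invariant_multiple f hf0
  refine sum_mul_exp_ne_zero_of_galois_invariant ι F.coeff hF hF0 ?_
  have hEF : E F = 0 := by
    obtain ⟨G, rfl⟩ := hfF
    rw [map_mul, hEf, zero_mul]
  simpa [E, e, AddMonoidAlgebra.lift_apply, Finsupp.sum] using hEF

/-- **Hermite–Lindemann theorem**. -/
theorem transcendental_exp_of_isAlgebraic {β : ℂ} (hβ : β ≠ 0) (halg : IsAlgebraic ℚ β) :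
    Transcendental ℚ (Complex.exp β) := by
  let p := minpoly ℚ β
  let K := IntermediateField.adjoin ℚ (p.rootSet ℂ)
  have : p.IsSplittingField ℚ K :=
    IntermediateField.adjoin_rootSet_isSplittingField (IsAlgClosed.splits _)
  have : FiniteDimensional ℚ K := IsSplittingField.finiteDimensional K p
  have : NumberField K := ⟨⟩
  have : Normal ℚ K := Normal.of_isSplittingField p
  have : IsGalois ℚ K := ⟨⟩
  have hmem : β ∈ K := IntermediateField.subset_adjoin _ _ <|
    (mem_rootSet_of_ne (minpoly.ne_zero halg.isIntegral)).2 (minpoly.aeval ℚ β)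
  intro h
  exact transcendental_exp_of_numberField (algebraMap K ℂ) (β := ⟨β, hmem⟩)
    (fun h0 ↦ hβ (congrArg Subtype.val h0)) ((IsFractionRing.isAlgebraic_iff ℤ ℚ ℂ).2 h)

/-- For every algebraic complex number `α` with `log α ≠ 0`, `log α` is transcendental. -/
theorem transcendental_log_of_algebraic (α : ℂ) (hlog : Complex.log α ≠ 0)
    (halg : IsAlgebraic ℚ α) : Transcendental ℚ (Complex.log α) := by
  intro h
  have hα : α ≠ 0 := by
    rintro rfl
    exact hlog Complex.log_zero
  refine transcendental_exp_of_isAlgebraic hlog h ?_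
  rwa [Complex.exp_log hα]
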